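/- Let n ≥ 1. Let φ : ℝⁿ → ℝ be a differentiable convex function whose gradient ∇φ : ℝⁿ → ℝⁿ is a bijection with continuous inverse. Let H : ℝⁿ ⇉ ℝⁿ be a set-valued mapping with closed graph and nonempty closed values. Let {x_k}, {d_k}, {ξ_k} ⊂ ℝⁿ and positive reals {η_k} satisfy: ∇φ(x_{k+1}) = ∇φ(x_k) − η_k (d_k + ξ_k); the sequences {x_k}, {∇φ(x_k)}, {d_k} are bounded; ∑_{k=0}^∞ η_k = ∞ and lim_{k→∞} η_k = 0; for every T > 0, lim_{s→∞} sup_{s ≤ i ≤ Λ_η(λ_η(s)+T)} ‖∑_{k=s}^{i} η_k ξ_k‖ = 0; and for every strictly increasing {k_j} with x_{k_j} → x̄, lim_{N→∞} dist( (1/N) ∑_{j=1}^{N} d_{k_j} , H(x̄) ) = 0. Let Ψ : ℝⁿ → ℝ be continuous and bounded below, suppose the set {Ψ(x) : 0 ∈ H(x)} has empty interior in ℝ, and suppose that for every continuous curve x : [0, ∞) → ℝⁿ for which there exists a locally integrable d̄ : [0, ∞) → ℝⁿ with d̄(s) ∈ H(x(s)) for almost every s ≥ 0 and ∇φ(x(t))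 = ∇φ(x(0)) − ∫_0^t d̄(s) ds for all t ≥ 0, and with 0 ∉ H(x(0)), there exists T > 0 such that Ψ(x(T)) < sup_{t∈[0,T]} Ψ(x(t)) ≤ Ψ(x(0)). Then every cluster point x* of the sequence {x_k} satisfies 0 ∈ H(x*), and the sequence {Ψ(x_k)} converges. -/

import Mathlib

open Filter Topology Metric MeasureTheory

/-- `λ_η(k) = ∑_{i=0}^{k−1} η_i` (with `λ_η(0) = 0`). -/
noncomputable def lamEta (η : ℕ → ℝ) (k : ℕ) : ℝ := ∑ i ∈ Finset.range k, η i

/-- `Λ_η(t) = sup {k ∈ ℕ : λ_η(k) ≤ t}`. -/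
noncomputable def LamEta (η : ℕ → ℝ) (t : ℝ) : ℕ := sSup {k : ℕ | lamEta η k ≤ t}

section Averaging

variable {E : Type*} [NormedAddCommGroup E] [InnerProductSpace ℝ E]

/-- If, in every direction `p`, terms `d k` with `x k` close to `xbar` are found infinitely often
on the side of `v` opposite to `p`, then some subsequence of `d` along which `x` tends to `xbar`
has averages tending to `v`. -/
theorem exists_subseq_tendsto_average {x d : ℕ → E} {xbar v : E} {D : ℝ}
    (hd : ∀ k, ‖d k‖ ≤ D)
    (h : ∀ (p : E) (ε : ℝ) (M : ℕ), 0 < ε →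
      ∃ k, M ≤ k ∧ ‖x k - xbar‖ < ε ∧ inner ℝ p (d k - v) < ε) :
    ∃ ks : ℕ → ℕ, StrictMono ks ∧ Tendsto (fun j => x (ks j)) atTop (𝓝 xbar) ∧
      Tendsto (fun N : ℕ => (N : ℝ)⁻¹ • ∑ j ∈ Finset.range N, d (ks j)) atTop (𝓝 v) := by
  have h' : ∀ (N : ℕ) (q : ℕ × E), ∃ k, q.1 < k ∧ ‖x k - xbar‖ < 1 / ((N : ℝ) + 1) ∧
      inner ℝ q.2 (d k - v) < 1 := by
    intro N q
    obtain ⟨k, hk, hx, hp⟩ := h q.2 (1 / ((N : ℝ) + 1)) (q.1 + 1) (by positivity)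
    exact ⟨k, hk, hx, hp.trans_le (by rw [div_le_one (by positivity)]; simp)⟩
  choose f hf using h'
  let st : ℕ → ℕ × E := fun N =>
    Nat.rec (0, 0) (fun N q => (f N q, q.2 + (d (f N q) - v))) N
  have hst : ∀ N, st (N + 1) = (f N (st N), (st N).2 + (d (f N (st N)) - v)) := fun N => rfl
  let ks : ℕ → ℕ := fun N => (st (N + 1)).1
  have hks : ∀ N, ks N = f N (st N) := fun N => rfl
  have hsum : ∀ N, (st N).2 = ∑ j ∈ Finset.range N, (d (ks j) - v) := by
    intro N
    induction N with
    | zero => simp [st]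
    | succ N ih => rw [Finset.sum_range_succ, ← ih, hst, hks]
  have hnorm : ∀ N : ℕ, ‖(st N).2‖ ^ 2 ≤ N * (2 + (D + ‖v‖) ^ 2) := by
    intro N
    induction N with
    | zero => simp [st]
    | succ N ih =>
      have h1 : ‖d (f N (st N)) - v‖ ≤ D + ‖v‖ :=
        (norm_sub_le _ _).trans (by gcongr; exact hd _)
      have h2 := pow_le_pow_left₀ (norm_nonneg _) h1 2
      have h3 := (hf N (st N)).2.2
      have h4 := norm_add_sq_real (st N).2 (d (f N (st N)) - v)
      rw [hst]
      push_cast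
      linarith
  refine ⟨ks, strictMono_nat_of_lt_succ fun N => (hf (N + 1) (st (N + 1))).1, ?_, ?_⟩
  · rw [tendsto_iff_norm_sub_tendsto_zero]
    exact squeeze_zero (fun _ => norm_nonneg _) (fun N => (hf N (st N)).2.1.le)
      tendsto_one_div_add_atTop_nhds_zero_nat
  · rw [tendsto_iff_norm_sub_tendsto_zero]
    have hlim : Tendsto (fun N : ℕ => √((2 + (D + ‖v‖) ^ 2) / N)) atTop (𝓝 0) := by
      have := (tendsto_const_div_atTop_nhds_zero_nat (2 + (D + ‖v‖) ^ 2)).sqrt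
      simpa using this
    refine squeeze_zero' (Eventually.of_forall fun _ => norm_nonneg _) ?_ hlim
    filter_upwards [eventually_gt_atTop 0] with N hN
    have hN' : (0 : ℝ) < N := by exact_mod_cast hN
    have heq : (N : ℝ)⁻¹ • ∑ j ∈ Finset.range N, d (ks j) - v = (N : ℝ)⁻¹ • (st N).2 := by
      rw [hsum, Finset.sum_sub_distrib, smul_sub, Finset.sum_const, Finset.card_range,
        ← Nat.cast_smul_eq_nsmul ℝ, inv_smul_smul₀ hN'.ne']
    rw [heq]
    apply Real.le_sqrt_of_sq_le
    rw [norm_smul, mul_pow, norm_inv, Real.norm_natCast]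
    calc ((N : ℝ)⁻¹) ^ 2 * ‖(st N).2‖ ^ 2
        ≤ ((N : ℝ)⁻¹) ^ 2 * (N * (2 + (D + ‖v‖) ^ 2)) := by gcongr; exact hnorm N
      _ = (2 + (D + ‖v‖) ^ 2) / N := by field_simp

end Averaging

section Time

variable {η : ℕ → ℝ}

theorem lamEta_strictMono (hη : ∀ k, 0 < η k) : StrictMono (lamEta η) :=
  strictMono_nat_of_lt_succ fun k => by
    simpa [lamEta, Finset.sum_range_succ] using hη k

theorem lamEta_nonneg (hη : ∀ k, 0 < η k) (k : ℕ) : 0 ≤ lamEta η k :=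
  Finset.sum_nonneg fun i _ => (hη i).le

theorem lamEta_sub {i j : ℕ} (hij : i ≤ j) :
    lamEta η j - lamEta η i = ∑ k ∈ Finset.Ico i j, η k :=
  (Finset.sum_Ico_eq_sub _ hij).symm

theorem bddAbove_lamEta_le (hdiv : Tendsto (lamEta η) atTop atTop) (t : ℝ) :
    BddAbove {k : ℕ | lamEta η k ≤ t} := by
  obtain ⟨M, hM⟩ := (hdiv.eventually_gt_atTop t).exists_forall_of_atTop
  exact ⟨M, fun k hk => by_contra fun h => (hM k (not_le.1 h).le).not_ge hk⟩

theorem le_LamEta (hdiv : Tendsto (lamEta η) atTop atTop) {k : ℕ} {t : ℝ}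
    (h : lamEta η k ≤ t) : k ≤ LamEta η t :=
  le_csSup (bddAbove_lamEta_le hdiv t) h

theorem lamEta_LamEta_le (hdiv : Tendsto (lamEta η) atTop atTop) {t : ℝ} (ht : 0 ≤ t) :
    lamEta η (LamEta η t) ≤ t :=
  Nat.sSup_mem (s := {k : ℕ | lamEta η k ≤ t}) ⟨0, by simpa [lamEta] using ht⟩
    (bddAbove_lamEta_le hdiv t)

theorem lt_lamEta_LamEta_add (hdiv : Tendsto (lamEta η) atTop atTop) (t : ℝ) :
    t < lamEta η (LamEta η t) + η (LamEta η t) := by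
  by_contra! h
  have := le_LamEta hdiv (k := LamEta η t + 1) (t := t)
    (by simpa [lamEta, Finset.sum_range_succ] using h)
  omega

theorem LamEta_lamEta (hη : ∀ k, 0 < η k) (hdiv : Tendsto (lamEta η) atTop atTop) (k : ℕ) :
    LamEta η (lamEta η k) = k :=
  le_antisymm ((lamEta_strictMono hη).le_iff_le.1 (lamEta_LamEta_le hdiv (lamEta_nonneg hη k)))
    (le_LamEta hdiv le_rfl)

theorem LamEta_mono (hdiv : Tendsto (lamEta η) atTop atTop) {t t' : ℝ}
    (ht : 0 ≤ t) (h : t ≤ t') : LamEta η t ≤ LamEta η t' :=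
  le_LamEta hdiv ((lamEta_LamEta_le hdiv ht).trans h)

/-- The elapsed time at the index reached `τ s` units of time after index `s` has the same limit
as `τ s`. -/
theorem tendsto_elapsed_time (hη : ∀ k, 0 < η k) (hdiv : Tendsto (lamEta η) atTop atTop)
    (hη0 : Tendsto η atTop (𝓝 0)) {l : Filter ℕ} (hl : l ≤ atTop) {τ : ℕ → ℝ} {t : ℝ}
    (hτ0 : ∀ᶠ s in l, 0 ≤ τ s) (hτ : Tendsto τ l (𝓝 t)) :
    Tendsto (fun s => lamEta η (LamEta η (lamEta η s + τ s)) - lamEta η s) l (𝓝 t) := by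
  have hκ : Tendsto (fun s => LamEta η (lamEta η s + τ s)) l atTop :=
    tendsto_atTop_mono' l (hτ0.mono fun s hs =>
      le_LamEta hdiv (k := s) (le_add_of_nonneg_right hs)) hl
  have hlow : Tendsto (fun s => τ s - η (LamEta η (lamEta η s + τ s))) l (𝓝 t) := by
    simpa using hτ.sub (hη0.comp hκ)
  refine tendsto_of_tendsto_of_tendsto_of_le_of_le' hlow hτ
    (Eventually.of_forall fun s => ?_) (hτ0.mono fun s hs => ?_)
  · linarith [lt_lamEta_LamEta_add hdiv (lamEta η s + τ s)]
  · linarith [lamEta_LamEta_le hdiv (add_nonneg (lamEta_nonneg hη s) hs)]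

end Time

section Noise

variable {E : Type*} [NormedAddCommGroup E] [NormedSpace ℝ E]

/-- Uniform smallness of all partial sums of the noise over a time window. -/
theorem eventually_norm_sum_Ico_le {ξ : ℕ → E} {η : ℕ → ℝ}
    (hdiv : Tendsto (lamEta η) atTop atTop)
    (hnoise : ∀ T : ℝ, 0 < T →
      Tendsto (fun s : ℕ =>
          ⨆ i ∈ Set.Icc s (LamEta η (lamEta η s + T)),
            ‖∑ k ∈ Finset.Icc s i, η k • ξ k‖) atTop (𝓝 0))
    {T ε : ℝ} (hT : 0 < T) (hε : 0 < ε) :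
    ∀ᶠ s in atTop, ∀ i j, s ≤ i → i ≤ j → lamEta η j ≤ lamEta η s + T →
      ‖∑ k ∈ Finset.Ico i j, η k • ξ k‖ ≤ ε := by
  filter_upwards [(hnoise T hT).eventually_lt_const (half_pos hε)] with s hs i j hsi hij hj
  have hbound : ∀ m ∈ Set.Icc s (LamEta η (lamEta η s + T)),
      ‖∑ k ∈ Finset.Icc s m, η k • ξ k‖ ≤ ε / 2 := by
    intro m hm
    refine le_trans ?_ hs.le
    let g : ℕ → ℝ := fun m => ⨆ _ : m ∈ Set.Icc s (LamEta η (lamEta η s + T)),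
      ‖∑ k ∈ Finset.Icc s m, η k • ξ k‖
    have hg : ∀ m, m ∉ Set.Icc s (LamEta η (lamEta η s + T)) → g m = 0 := fun m hm => by
      simp only [g]
      rw [ciSup_neg hm, Real.sSup_empty]
    have hbdd : BddAbove (Set.range g) := by
      refine (((Set.finite_Icc s (LamEta η (lamEta η s + T))).image g).union
        (Set.finite_singleton 0)).bddAbove.mono ?_
      rintro _ ⟨m, rfl⟩
      by_cases hm : m ∈ Set.Icc s (LamEta η (lamEta η s + T))
      · exact Or.inl ⟨m, hm, rfl⟩
      · exact Or.inr (hg m hm)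
    have := le_ciSup hbdd m
    simp only [g] at this
    rwa [ciSup_pos hm] at this
  have hIco : ∀ m, s ≤ m → m ≤ j → ‖∑ k ∈ Finset.Ico s m, η k • ξ k‖ ≤ ε / 2 := by
    intro m hsm hmj
    rcases hsm.eq_or_lt with rfl | hlt
    · simpa using (half_pos hε).le
    · obtain ⟨m, rfl⟩ : ∃ m', m = m' + 1 := ⟨m - 1, by omega⟩
      have := hbound m ⟨by omega, by have := le_LamEta hdiv hj; omega⟩
      rwa [← Finset.Ico_add_one_right_eq_Icc] at this
  have hsub : ∑ k ∈ Finset.Ico i j, η k • ξ k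
      = ∑ k ∈ Finset.Ico s j, η k • ξ k - ∑ k ∈ Finset.Ico s i, η k • ξ k := by
    rw [eq_sub_iff_add_eq', Finset.sum_Ico_consecutive _ hsi hij]
  rw [hsub]
  have := norm_sub_le (∑ k ∈ Finset.Ico s j, η k • ξ k) (∑ k ∈ Finset.Ico s i, η k • ξ k)
  linarith [hIco j (hsi.trans hij) le_rfl, hIco i hsi hij]

end Noise

/-- A Lipschitz curve in a finite-dimensional inner product space is the integral of its
derivative. -/
theorem LipschitzWith.integral_deriv_eq_sub_of_finiteDimensional {E : Type*}
    [NormedAddCommGroup E] [InnerProductSpace ℝ E] [FiniteDimensional ℝ E] {C : NNReal}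
    {Y : ℝ → E} (hY : LipschitzWith C Y) (a b : ℝ) :
    LocallyIntegrable (deriv Y) ∧ ∫ s in a..b, deriv Y s = Y b - Y a := by
  have hloc : LocallyIntegrable (deriv Y) :=
    (locallyIntegrable_const (C : ℝ)).mono (stronglyMeasurable_deriv Y).aestronglyMeasurable
      (Eventually.of_forall fun t => by simpa using norm_deriv_le_of_lipschitz hY)
  refine ⟨hloc, ext_inner_left ℝ fun p => ?_⟩
  have hint : IntervalIntegrable (deriv Y) volume a b := 
    ((hloc.locallyIntegrableOn _).integrableOn_isCompact isCompact_uIcc).intervalIntegrable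
  have hL : LipschitzWith (‖innerSL ℝ p‖₊ * C) (fun t => inner ℝ p (Y t)) :=
    (innerSL ℝ p).lipschitz.comp hY
  have hftc := (hL.lipschitzOnWith (s := Set.uIcc a b)).absolutelyContinuousOnInterval
    |>.integral_deriv_eq_sub
  have hcomm := (innerSL ℝ p).intervalIntegral_comp_comm hint
  simp only [innerSL_apply_apply] at hcomm
  rw [← hcomm, inner_sub_right, ← hftc]
  refine intervalIntegral.integral_congr_ae ?_
  filter_upwards [hY.ae_differentiableAt_real] with t ht _
  exact ((innerSL ℝ p).hasFDerivAt.comp_hasDerivAt t ht.hasDerivAt).deriv.symm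

section LimitCurve

variable {E : Type*} [NormedAddCommGroup E] [InnerProductSpace ℝ E]

/-- The index reached `t` units of time after index `s`. -/
noncomputable def indexAfter (η : ℕ → ℝ) (s : ℕ) (t : ℝ) : ℕ := LamEta η (lamEta η s + t)

variable {η : ℕ → ℝ} {y d : ℕ → E} {D : ℝ}

theorem norm_sum_smul_le (hη : ∀ k, 0 < η k) (hd : ∀ k, ‖d k‖ ≤ D) {i j : ℕ} (hij : i ≤ j) :
    ‖∑ k ∈ Finset.Ico i j, η k • d k‖ ≤ D * (lamEta η j - lamEta η i) := by
  rw [lamEta_sub hij, Finset.mul_sum]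
  refine norm_sum_le_of_le _ fun k _ => ?_
  rw [norm_smul, Real.norm_of_nonneg (hη k).le, mul_comm]
  exact mul_le_mul_of_nonneg_right (hd k) (hη k).le

/-- Increments of `y` are asymptotically Lipschitz in elapsed time. -/
theorem eventually_norm_sub_le (hη : ∀ k, 0 < η k) (hd : ∀ k, ‖d k‖ ≤ D)
    (hy : ∀ T ε : ℝ, 0 < T → 0 < ε → ∀ᶠ s in atTop, ∀ i j, s ≤ i → i ≤ j →
      lamEta η j ≤ lamEta η s + T → ‖y j - y i + ∑ k ∈ Finset.Ico i j, η k • d k‖ ≤ ε)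
    {T ε : ℝ} (hT : 0 < T) (hε : 0 < ε) :
    ∀ᶠ s in atTop, ∀ i j, s ≤ i → i ≤ j → lamEta η j ≤ lamEta η s + T →
      ‖y j - y i‖ ≤ D * (lamEta η j - lamEta η i) + ε := by
  filter_upwards [hy T ε hT hε] with s hs i j hsi hij hj
  have h1 := hs i j hsi hij hj
  have h2 := norm_sum_smul_le hη hd hij
  have h3 := norm_sub_le (y j - y i + ∑ k ∈ Finset.Ico i j, η k • d k)
    (∑ k ∈ Finset.Ico i j, η k • d k)
  rw [add_sub_cancel_right] at h3
  linarith

theorem indexAfter_zero (hη : ∀ k, 0 < η k) (hdiv : Tendsto (lamEta η) atTop atTop) (s : ℕ) :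
    indexAfter η s 0 = s := by
  rw [indexAfter, add_zero, LamEta_lamEta hη hdiv]

theorem indexAfter_sub (hη : ∀ k, 0 < η k) (hdiv : Tendsto (lamEta η) atTop atTop) (s e : ℕ) :
    indexAfter η s (lamEta η e - lamEta η s) = e := by
  rw [indexAfter, add_sub_cancel, LamEta_lamEta hη hdiv]

theorem lamEta_indexAfter_le (hη : ∀ k, 0 < η k) (hdiv : Tendsto (lamEta η) atTop atTop) (s : ℕ)
    {t : ℝ} (ht : 0 ≤ t) : lamEta η (indexAfter η s t) ≤ lamEta η s + t :=
  lamEta_LamEta_le hdiv (add_nonneg (lamEta_nonneg hη s) ht)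

theorem le_indexAfter (hdiv : Tendsto (lamEta η) atTop atTop) (s : ℕ) {t : ℝ} (ht : 0 ≤ t) :
    s ≤ indexAfter η s t :=
  le_LamEta hdiv (le_add_of_nonneg_right ht)

theorem indexAfter_mono (hη : ∀ k, 0 < η k) (hdiv : Tendsto (lamEta η) atTop atTop) (s : ℕ)
    {t t' : ℝ} (ht : 0 ≤ t) (htt' : t ≤ t') : indexAfter η s t ≤ indexAfter η s t' :=
  LamEta_mono hdiv (add_nonneg (lamEta_nonneg hη s) ht) (by linarith)

/-- The process `y`, run from index `s` in elapsed time, converges along any ultrafilter of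
starting indices to a Lipschitz curve. -/
theorem exists_limit_curve [FiniteDimensional ℝ E] (hη : ∀ k, 0 < η k)
    (hdiv : Tendsto (lamEta η) atTop atTop)
    (hη0 : Tendsto η atTop (𝓝 0)) (hd : ∀ k, ‖d k‖ ≤ D)
    (hybd : Bornology.IsBounded (Set.range y))
    (hy : ∀ T ε : ℝ, 0 < T → 0 < ε → ∀ᶠ s in atTop, ∀ i j, s ≤ i → i ≤ j →
      lamEta η j ≤ lamEta η s + T → ‖y j - y i + ∑ k ∈ Finset.Ico i j, η k • d k‖ ≤ ε)
    (U : Ultrafilter ℕ) (hU : (U : Filter ℕ) ≤ atTop) :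
    ∃ Y : ℝ → E, LipschitzWith D.toNNReal Y ∧
      ∀ t, 0 ≤ t → Tendsto (fun s => y (indexAfter η s t)) U (𝓝 (Y t)) := by
  have : ProperSpace E := FiniteDimensional.proper ℝ E
  have hlim : ∀ t : ℝ, ∃ z, Tendsto (fun s => y (indexAfter η s (max t 0))) U (𝓝 z) := by
    intro t
    obtain ⟨z, -, hz⟩ := hybd.isCompact_closure.ultrafilter_le_nhds
      (U.map fun s => y (indexAfter η s (max t 0)))
      (le_principal_iff.2 (mem_map.2 (univ_mem' fun s => subset_closure ⟨_, rfl⟩)))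
    exact ⟨z, hz⟩
  choose Y hY using hlim
  have hD : 0 ≤ D := (norm_nonneg _).trans (hd 0)
  have key : ∀ t t' : ℝ, t ≤ t' → ‖Y t' - Y t‖ ≤ D * (t' - t) := by
    intro t t' htt'
    have h0 : max t 0 ≤ max t' 0 := max_le_max_right 0 htt'
    have h1 : max t' 0 - max t 0 ≤ t' - t := by
      have := max_sub_max_le_max t' 0 t 0
      simpa [htt'] using this
    refine le_trans ?_ (mul_le_mul_of_nonneg_left h1 hD)
    refine le_of_forall_pos_le_add fun ε hε => ?_
    have hl := ((hY t').sub (hY t)).norm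
    have hr := (((tendsto_elapsed_time hη hdiv hη0 hU (Eventually.of_forall fun _ => le_max_right t' 0)
      tendsto_const_nhds).sub (tendsto_elapsed_time hη hdiv hη0 hU
        (Eventually.of_forall fun _ => le_max_right t 0) tendsto_const_nhds)).const_mul
          D).add_const ε
    refine le_of_tendsto_of_tendsto hl hr ?_
    have hT : 0 < max t' 0 + 1 := by positivity
    filter_upwards [hU (eventually_norm_sub_le hη hd hy hT hε)] with s hs
    have := hs (indexAfter η s (max t 0)) (indexAfter η s (max t' 0))
      (le_indexAfter hdiv s (le_max_right t 0)) (indexAfter_mono hη hdiv s (le_max_right t 0) h0)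
      (by linarith [lamEta_indexAfter_le hη hdiv s (le_max_right t' 0)])
    simpa [indexAfter] using this
  refine ⟨Y, LipschitzWith.of_dist_le_mul fun t t' => ?_, fun t ht => ?_⟩
  · rw [Real.coe_toNNReal _ hD, dist_eq_norm, Real.dist_eq]
    rcases le_total t t' with h | h
    · rw [norm_sub_rev, abs_sub_comm, abs_of_nonneg (sub_nonneg.2 h)]
      exact key t t' h
    · rw [abs_of_nonneg (sub_nonneg.2 h)]
      exact key t' t h
  · simpa [max_eq_left ht] using hY t

/-- The convergence of `exists_limit_curve` is continuous in the elapsed time. -/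
theorem tendsto_indexAfter_of_tendsto (hη : ∀ k, 0 < η k)
    (hdiv : Tendsto (lamEta η) atTop atTop)
    (hη0 : Tendsto η atTop (𝓝 0)) (hd : ∀ k, ‖d k‖ ≤ D)
    (hy : ∀ T ε : ℝ, 0 < T → 0 < ε → ∀ᶠ s in atTop, ∀ i j, s ≤ i → i ≤ j →
      lamEta η j ≤ lamEta η s + T → ‖y j - y i + ∑ k ∈ Finset.Ico i j, η k • d k‖ ≤ ε)
    {l : Filter ℕ} (hl : l ≤ atTop) {τ : ℕ → ℝ} {t : ℝ} {z : E} (ht : 0 ≤ t)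
    (hY : Tendsto (fun s => y (indexAfter η s t)) l (𝓝 z))
    (hτ0 : ∀ᶠ s in l, 0 ≤ τ s) (hτ : Tendsto τ l (𝓝 t)) :
    Tendsto (fun s => y (indexAfter η s (τ s))) l (𝓝 z) := by
  suffices hdiff : Tendsto (fun s => y (indexAfter η s (τ s)) - y (indexAfter η s t)) l (𝓝 0) by
    simpa using hdiff.add hY
  refine NormedAddGroup.tendsto_nhds_zero.2 fun ε hε => ?_
  have hel : Tendsto (fun s => D * |lamEta η (indexAfter η s (τ s)) - lamEta η s
      - (lamEta η (indexAfter η s t) - lamEta η s)|) l (𝓝 (D * |t - t|)) :=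
    ((tendsto_elapsed_time hη hdiv hη0 hl hτ0 hτ).sub (tendsto_elapsed_time hη hdiv hη0 hl
      (Eventually.of_forall fun _ => ht) tendsto_const_nhds)).abs.const_mul D
  filter_upwards [hτ0, hτ.eventually_lt_const (lt_add_one t),
    hel.eventually_lt_const (u := ε / 2) (by simpa using half_pos hε),
    hl (eventually_norm_sub_le hη hd hy (by linarith : 0 < t + 1) (half_pos hε))]
    with s h0 h1 h2 h3
  have hb1 := lamEta_indexAfter_le hη hdiv s h0
  have hb2 := lamEta_indexAfter_le hη hdiv s ht
  rw [sub_sub_sub_cancel_right] at h2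
  have hmono := (lamEta_strictMono hη).monotone
  rcases le_total (τ s) t with h | h
  · have hidx := indexAfter_mono hη hdiv s h0 h
    have := h3 _ _ (le_indexAfter hdiv s h0) hidx (by linarith)
    rw [abs_sub_comm, abs_of_nonneg (sub_nonneg.2 (hmono hidx))] at h2
    rw [norm_sub_rev]
    linarith
  · have hidx := indexAfter_mono hη hdiv s ht h
    have := h3 _ _ (le_indexAfter hdiv s ht) hidx (by linarith)
    rw [abs_of_nonneg (sub_nonneg.2 (hmono hidx))] at h2
    linarith

/-- At a point of differentiability of a limit curve, minus the derivative cannot be strictly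
separated from the directions `d k` occurring near the limit point. -/
theorem exists_inner_sub_lt_of_hasDerivAt (hη : ∀ k, 0 < η k)
    (hdiv : Tendsto (lamEta η) atTop atTop)
    (hη0 : Tendsto η atTop (𝓝 0)) (hd : ∀ k, ‖d k‖ ≤ D)
    (hy : ∀ T ε : ℝ, 0 < T → 0 < ε → ∀ᶠ s in atTop, ∀ i j, s ≤ i → i ≤ j →
      lamEta η j ≤ lamEta η s + T → ‖y j - y i + ∑ k ∈ Finset.Ico i j, η k • d k‖ ≤ ε)
    (U : Ultrafilter ℕ) (hU : (U : Filter ℕ) ≤ atTop) {Y : ℝ → E}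
    (hY : ∀ t, 0 ≤ t → Tendsto (fun s => y (indexAfter η s t)) U (𝓝 (Y t)))
    {ψ : E → E} (hψ : Continuous ψ) {t : ℝ} (ht : 0 ≤ t) {v : E} (hv : HasDerivAt Y (-v) t)
    (p : E) {ε : ℝ} (M : ℕ) (hε : 0 < ε) :
    ∃ k, M ≤ k ∧ ‖ψ (y k) - ψ (Y t)‖ < ε ∧ inner ℝ p (d k - v) < ε := by
  by_contra! hcon
  have hD : 0 ≤ D := (norm_nonneg _).trans (hd 0)
  obtain ⟨δ, hδ, hψδ⟩ := Metric.continuous_iff.1 hψ (Y t) ε hε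
  set c := inner ℝ p v + ε with hc
  have hstep : ∀ h : ℝ, 0 < h → D * h < δ / 2 → inner ℝ p (Y (t + h) - Y t) ≤ -(c * h) := by
    intro h hh hDh
    have hth : 0 ≤ t + h := by linarith
    refine le_of_forall_pos_le_add fun ε' hε' => ?_
    have hl : Tendsto (fun s => inner ℝ p (y (indexAfter η s (t + h)) - y (indexAfter η s t))) U
        (𝓝 (inner ℝ p (Y (t + h) - Y t))) :=
      tendsto_const_nhds.inner ((hY _ hth).sub (hY _ ht))
    have hel := (tendsto_elapsed_time hη hdiv hη0 hU (Eventually.of_forall fun _ => hth)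
      tendsto_const_nhds).sub (tendsto_elapsed_time hη hdiv hη0 hU
        (Eventually.of_forall fun _ => ht) tendsto_const_nhds)
    rw [add_sub_cancel_left] at hel
    have hr := ((hel.const_mul c).neg).add_const ε'
    refine le_of_tendsto_of_tendsto hl hr ?_
    have hT : 0 < t + h := by linarith
    have hε'' : 0 < ε' / (‖p‖ + 1) := by positivity
    have hnear : ∀ᶠ s in (U : Filter ℕ), ‖y (indexAfter η s t) - Y t‖ < δ / 4 := by
      filter_upwards [(hY t ht).eventually (Metric.ball_mem_nhds _ (by positivity : 0 < δ / 4))]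
        with s hs
      rwa [← dist_eq_norm]
    have hel' : ∀ᶠ s in (U : Filter ℕ), D * (lamEta η (indexAfter η s (t + h))
        - lamEta η s - (lamEta η (indexAfter η s t) - lamEta η s)) < δ / 2 :=
      (hel.const_mul D).eventually_lt_const hDh
    filter_upwards [hnear, hel', hU (hy (t + h) _ hT hε''), hU (eventually_ge_atTop M),
      hU (eventually_norm_sub_le hη hd hy hT (by positivity : 0 < δ / 4))]
      with s hs1 hs2 hs3 hsM hs4
    change _ ≤ -(c * (lamEta η (indexAfter η s (t + h)) - lamEta η s
      - (lamEta η (indexAfter η s t) - lamEta η s))) + ε'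
    set a := indexAfter η s t with ha
    set b := indexAfter η s (t + h) with hb
    have hsa : s ≤ a := le_indexAfter hdiv s ht
    have hab : a ≤ b := indexAfter_mono hη hdiv s ht (by linarith)
    have hbT : lamEta η b ≤ lamEta η s + (t + h) := lamEta_indexAfter_le hη hdiv s hth
    have hdir : ∀ k ∈ Finset.Ico a b, c ≤ inner ℝ p (d k) := by
      intro k hk
      rw [Finset.mem_Ico] at hk
      have hkb : lamEta η k ≤ lamEta η b := (lamEta_strictMono hη).monotone hk.2.le
      have h1 := hs4 a k hsa hk.1 (hkb.trans hbT)
      have h2 : D * (lamEta η k - lamEta η a) ≤ D * (lamEta η b - lamEta η a) := by gcongr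
      have h3 : dist (y k) (Y t) < δ := by
        rw [dist_eq_norm]
        have := norm_add_le (y k - y a) (y a - Y t)
        rw [sub_add_sub_cancel] at this
        nlinarith
      have h4 := hcon k (hsM.trans (hsa.trans hk.1)) (by rw [← dist_eq_norm]; exact hψδ _ h3)
      rw [inner_sub_right] at h4
      linarith
    have hsum : c * (lamEta η b - lamEta η a) ≤ inner ℝ p (∑ k ∈ Finset.Ico a b, η k • d k) := by
      rw [inner_sum, lamEta_sub hab, Finset.mul_sum]
      refine Finset.sum_le_sum fun k hk => ?_
      rw [real_inner_smul_right, mul_comm]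
      exact mul_le_mul_of_nonneg_left (hdir k hk) (hη k).le
    have hrem : inner ℝ p (y b - y a + ∑ k ∈ Finset.Ico a b, η k • d k) ≤ ε' := by
      refine (real_inner_le_norm _ _).trans ?_
      calc ‖p‖ * ‖y b - y a + ∑ k ∈ Finset.Ico a b, η k • d k‖
          ≤ (‖p‖ + 1) * (ε' / (‖p‖ + 1)) := by
            gcongr
            · linarith
            · exact hs3 a b hsa hab hbT
        _ = ε' := by field_simp
    rw [inner_add_right] at hrem
    linarith
  have hslope : Tendsto (fun h : ℝ => inner ℝ p (h⁻¹ • (Y (t + h) - Y t))) (𝓝[>] 0)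
      (𝓝 (inner ℝ p (-v))) :=
    tendsto_const_nhds.inner hv.tendsto_slope_zero_right
  have hle : inner ℝ p (-v) ≤ -c := by
    refine le_of_tendsto hslope ?_
    have hsmall : ∀ᶠ h : ℝ in 𝓝[>] 0, D * h < δ / 2 := by
      refine nhdsWithin_le_nhds ?_
      have : Tendsto (fun h : ℝ => D * h) (𝓝 0) (𝓝 (D * 0)) := tendsto_id.const_mul D
      exact this.eventually_lt_const (by simpa using half_pos hδ)
    filter_upwards [hsmall, self_mem_nhdsWithin] with h h1 (h2 : 0 < h)
    rw [real_inner_smul_right, inv_mul_le_iff₀ h2]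
    linarith [hstep h h2 h1]
  rw [inner_neg_right] at hle
  linarith

end LimitCurve

/-- A sequence that is frequently below `r` and frequently at least `r'`, where `r < r'`,
frequently leaves `{· ≤ r}` and then reaches `r'` without returning. -/
theorem frequently_upcrossing {f : ℕ → ℝ} {r r' : ℝ} (hr : r < r')
    (hlow : ∃ᶠ k in atTop, f k ≤ r) (hhigh : ∃ᶠ k in atTop, r' ≤ f k) :
    ∃ᶠ s in atTop, f s ≤ r ∧ ∃ e, s < e ∧ r' ≤ f e ∧ ∀ k, s < k → k ≤ e → r < f k := by
  rw [frequently_atTop] at hlow hhigh ⊢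
  intro M
  obtain ⟨m, hMm, hm⟩ := hlow M
  obtain ⟨e, hme, he⟩ := hhigh m
  let s := Nat.findGreatest (fun k => f k ≤ r) e
  have hms : m ≤ s := Nat.le_findGreatest hme hm
  have hs : f s ≤ r := Nat.findGreatest_spec (P := fun k => f k ≤ r) hme hm
  refine ⟨s, hMm.trans hms, hs, e, ?_, he, fun k hk hke =>
    not_le.1 (Nat.findGreatest_is_greatest hk hke)⟩
  refine lt_of_le_of_ne (Nat.findGreatest_le e) fun h => ?_
  rw [h] at hs
  linarith

/-- A bounded real sequence converges if its upper and lower cluster values are not separated by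
any two reals, the first of which may be chosen outside a set with empty interior. -/
theorem exists_tendsto_of_no_oscillation {f : ℕ → ℝ} {A : Set ℝ} (hA : interior A = ∅)
    (hbelow : BddBelow (Set.range f)) (habove : BddAbove (Set.range f))
    (h : ∀ r r', r < r' → r ∉ A → (∃ᶠ k in atTop, f k ≤ r) → ¬ ∃ᶠ k in atTop, r' ≤ f k) :
    ∃ c, Tendsto f atTop (𝓝 c) := by
  have hdense : Dense Aᶜ := interior_eq_empty_iff_dense_compl.1 hA
  refine tendsto_of_no_upcrossings dense_univ (fun a _ b _ hab ⟨hlow, hhigh⟩ => ?_)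
    habove.isBoundedUnder_of_range hbelow.isBoundedUnder_of_range
  obtain ⟨r, hrA, har, hrb⟩ := hdense.exists_between hab
  exact h r b hrb hrA (hlow.mono fun k hk => (hk.trans har).le) (hhigh.mono fun k hk => hk.le)

/-- Unfolds the Lyapunov conclusion, stated with nested real suprema, to pointwise bounds. -/
theorem lt_and_le_of_biSup {g : ℝ → ℝ} {T : ℝ} (hg : ContinuousOn g (Set.Icc 0 T))
    (h1 : g T < ⨆ t ∈ Set.Icc (0 : ℝ) T, g t) (h2 : (⨆ t ∈ Set.Icc (0 : ℝ) T, g t) ≤ g 0) :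
    g T < g 0 ∧ ∀ t ∈ Set.Icc (0 : ℝ) T, g t ≤ g 0 := by
  refine ⟨h1.trans_le h2, fun t ht => le_trans ?_ h2⟩
  obtain ⟨B, hB⟩ := isCompact_Icc.bddAbove_image hg
  have hbdd : BddAbove (Set.range fun t => ⨆ _ : t ∈ Set.Icc (0 : ℝ) T, g t) := by
    refine ⟨max B 0, ?_⟩
    rintro _ ⟨u, rfl⟩
    by_cases hu : u ∈ Set.Icc (0 : ℝ) T
    · simp only [ciSup_pos hu]
      exact (hB ⟨u, hu, rfl⟩).trans (le_max_left _ _)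
    · simp only [ciSup_neg hu, Real.sSup_empty]
      exact le_max_right _ _
  simpa only [ciSup_pos ht] using le_ciSup hbdd t

/-- Convergence of the general Bregman-type method: under the stated
assumptions on the kernel `φ`, the set-valued map `H`, the iterates, the noise, the
averaging property of the directions, and the Lyapunov function `Ψ`, every cluster
point `x*` of `{x_k}` satisfies `0 ∈ H(x*)` and `{Ψ(x_k)}` converges. -/
theorem stmt10 (n : ℕ) (hn : 1 ≤ n)
    (φ : EuclideanSpace ℝ (Fin n) → ℝ) (hφdiff : Differentiable ℝ φ)
    (hφconv : ConvexOn ℝ Set.univ φ)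
    (ψ : EuclideanSpace ℝ (Fin n) → EuclideanSpace ℝ (Fin n))
    (hψcont : Continuous ψ)
    (hψleft : Function.LeftInverse ψ (gradient φ))
    (hψright : Function.RightInverse ψ (gradient φ))
    (H : EuclideanSpace ℝ (Fin n) → Set (EuclideanSpace ℝ (Fin n)))
    (hgraph : IsClosed {p : EuclideanSpace ℝ (Fin n) × EuclideanSpace ℝ (Fin n) |
        p.2 ∈ H p.1})
    (hne : ∀ x, (H x).Nonempty) (hcl : ∀ x, IsClosed (H x))
    (x d ξ : ℕ → EuclideanSpace ℝ (Fin n)) (η : ℕ → ℝ) (hηpos : ∀ k, 0 < η k)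
    (hrec : ∀ k, gradient φ (x (k + 1)) = gradient φ (x k) - η k • (d k + ξ k))
    (hxbd : Bornology.IsBounded (Set.range x))
    (hgxbd : Bornology.IsBounded (Set.range (fun k => gradient φ (x k))))
    (hdbd : Bornology.IsBounded (Set.range d))
    (hdiv : Tendsto (fun m => ∑ k ∈ Finset.range m, η k) atTop atTop)
    (hη0 : Tendsto η atTop (nhds 0))
    (hnoise : ∀ T : ℝ, 0 < T →
      Tendsto (fun s : ℕ =>
          ⨆ i ∈ Set.Icc s (LamEta η (lamEta η s + T)),
            ‖∑ k ∈ Finset.Icc s i, η k • ξ k‖) atTop (nhds 0))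
    (havg : ∀ ks : ℕ → ℕ, StrictMono ks → ∀ xbar : EuclideanSpace ℝ (Fin n),
      Tendsto (fun j => x (ks j)) atTop (nhds xbar) →
      Tendsto (fun N : ℕ =>
          Metric.infDist ((N : ℝ)⁻¹ • ∑ j ∈ Finset.range N, d (ks j)) (H xbar))
        atTop (nhds 0))
    (Ψ : EuclideanSpace ℝ (Fin n) → ℝ) (hΨcont : Continuous Ψ)
    (hΨbd : BddBelow (Set.range Ψ))
    (hSard : interior {c : ℝ | ∃ w : EuclideanSpace ℝ (Fin n),
        (0 : EuclideanSpace ℝ (Fin n)) ∈ H w ∧ Ψ w = c} = ∅)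
    (hLyap : ∀ xc : ℝ → EuclideanSpace ℝ (Fin n), ContinuousOn xc (Set.Ici (0 : ℝ)) →
      (∃ dbar : ℝ → EuclideanSpace ℝ (Fin n),
        LocallyIntegrableOn dbar (Set.Ici (0 : ℝ)) ∧
        (∀ᵐ s ∂(volume.restrict (Set.Ici (0 : ℝ))), dbar s ∈ H (xc s)) ∧
        ∀ t : ℝ, 0 ≤ t →
          gradient φ (xc t) = gradient φ (xc 0) - ∫ s in (0 : ℝ)..t, dbar s) →
      (0 : EuclideanSpace ℝ (Fin n)) ∉ H (xc 0) →
      ∃ T : ℝ, 0 < T ∧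
        Ψ (xc T) < (⨆ t ∈ Set.Icc (0 : ℝ) T, Ψ (xc t)) ∧
        (⨆ t ∈ Set.Icc (0 : ℝ) T, Ψ (xc t)) ≤ Ψ (xc 0)) :
    (∀ xstar : EuclideanSpace ℝ (Fin n),
      (∃ ks : ℕ → ℕ, StrictMono ks ∧ Tendsto (fun j => x (ks j)) atTop (nhds xstar)) →
      (0 : EuclideanSpace ℝ (Fin n)) ∈ H xstar) ∧
    ∃ c : ℝ, Tendsto (fun k => Ψ (x k)) atTop (nhds c) := by
  obtain ⟨D, hD⟩ := hdbd.exists_norm_le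
  replace hD : ∀ k, ‖d k‖ ≤ D := fun k => hD _ ⟨k, rfl⟩
  have hdiv' : Tendsto (lamEta η) atTop atTop := hdiv
  set y : ℕ → EuclideanSpace ℝ (Fin n) := fun k => gradient φ (x k) with hydef
  have hψy : ∀ k, ψ (y k) = x k := fun k => hψleft (x k)
  have hincr : ∀ i j, i ≤ j → y j - y i + ∑ k ∈ Finset.Ico i j, η k • d k
      = -∑ k ∈ Finset.Ico i j, η k • ξ k := by
    intro i j hij
    induction j, hij using Nat.le_induction with
    | base => simp
    | succ j hij ih =>
      rw [Finset.sum_Ico_succ_top hij, Finset.sum_Ico_succ_top hij, neg_add, ← ih]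
      simp only [hydef, hrec j, smul_add]
      abel
  have hy : ∀ T ε : ℝ, 0 < T → 0 < ε → ∀ᶠ s in atTop, ∀ i j, s ≤ i → i ≤ j →
      lamEta η j ≤ lamEta η s + T → ‖y j - y i + ∑ k ∈ Finset.Ico i j, η k • d k‖ ≤ ε := by
    intro T ε hT hε
    filter_upwards [eventually_norm_sum_Ico_le hdiv' hnoise hT hε] with s hs i j hsi hij hj
    rw [hincr i j hij, norm_neg]
    exact hs i j hsi hij hj
  have hdescent : ∀ U : Ultrafilter ℕ, (U : Filter ℕ) ≤ atTop → ∀ Y,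
      LipschitzWith D.toNNReal Y →
      (∀ t, 0 ≤ t → Tendsto (fun s => y (indexAfter η s t)) U (𝓝 (Y t))) →
      0 ∉ H (ψ (Y 0)) → ∃ T : ℝ, 0 < T ∧ Ψ (ψ (Y T)) < Ψ (ψ (Y 0)) ∧
        ∀ t ∈ Set.Icc (0 : ℝ) T, Ψ (ψ (Y t)) ≤ Ψ (ψ (Y 0)) := by
    intro U hU Y hYlip hY h0
    have hcont : Continuous fun t => ψ (Y t) := hψcont.comp hYlip.continuous
    have htraj : ∃ dbar : ℝ → EuclideanSpace ℝ (Fin n),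
        LocallyIntegrableOn dbar (Set.Ici (0 : ℝ)) ∧
        (∀ᵐ s ∂(volume.restrict (Set.Ici (0 : ℝ))), dbar s ∈ H (ψ (Y s))) ∧
        ∀ t : ℝ, 0 ≤ t → gradient φ (ψ (Y t)) = gradient φ (ψ (Y 0)) - ∫ s in (0 : ℝ)..t, dbar s := by
      refine ⟨fun t => -deriv Y t,
        (hYlip.integral_deriv_eq_sub_of_finiteDimensional 0 0).1.neg.locallyIntegrableOn _, ?_, ?_⟩
      · rw [ae_restrict_iff' measurableSet_Ici]
        filter_upwards [hYlip.ae_differentiableAt_real] with t ht (ht0 : 0 ≤ t)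
        obtain ⟨ks, hks, hxks, hdks⟩ := exists_subseq_tendsto_average (x := x) (xbar := ψ (Y t))
          (v := -deriv Y t) hD fun p ε M hε => by
            have := exists_inner_sub_lt_of_hasDerivAt hηpos hdiv' hη0 hD hy U hU hY hψcont ht0
              (v := -deriv Y t) (by simpa using ht.hasDerivAt) p M hε
            simpa only [hψy] using this
        have h3 := havg ks hks _ hxks
        have h4 := ((Metric.continuous_infDist_pt (H (ψ (Y t)))).tendsto _).comp hdks
        exact ((hcl _).mem_iff_infDist_zero (hne _)).2 (tendsto_nhds_unique h4 h3)
      · intro t ht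
        rw [hψright, hψright, intervalIntegral.integral_neg,
          (hYlip.integral_deriv_eq_sub_of_finiteDimensional 0 t).2]
        abel
    obtain ⟨T, hT, h1, h2⟩ := hLyap (fun t => ψ (Y t)) hcont.continuousOn htraj h0
    exact ⟨T, hT, lt_and_le_of_biSup (hΨcont.comp hcont).continuousOn h1 h2⟩
  have hΨlim : ∀ (U : Ultrafilter ℕ) (Y : ℝ → EuclideanSpace ℝ (Fin n)) (t : ℝ) (κ : ℕ → ℕ),
      Tendsto (fun s => y (κ s)) U (𝓝 (Y t)) →
      Tendsto (fun s => Ψ (x (κ s))) U (𝓝 (Ψ (ψ (Y t)))) := by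
    intro U Y t κ h
    simpa only [Function.comp_def, hψy] using
      ((hΨcont.comp hψcont).tendsto (Y t)).comp h
  have hconv : ∃ c : ℝ, Tendsto (fun k => Ψ (x k)) atTop (𝓝 c) := by
    have habove : BddAbove (Set.range fun k => Ψ (x k)) := by
      refine (hxbd.isCompact_closure.bddAbove_image hΨcont.continuousOn).mono ?_
      rintro _ ⟨k, rfl⟩
      exact ⟨x k, subset_closure ⟨k, rfl⟩, rfl⟩
    have hbelow : BddBelow (Set.range fun k => Ψ (x k)) :=
      hΨbd.mono (Set.range_comp_subset_range x Ψ)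
    refine exists_tendsto_of_no_oscillation hSard hbelow habove fun r r' hr hrA hlow hhigh => ?_
    have hup := frequently_upcrossing hr hlow hhigh
    have : NeBot (atTop ⊓ 𝓟 {s | Ψ (x s) ≤ r ∧ ∃ e, s < e ∧ r' ≤ Ψ (x e) ∧
        ∀ k, s < k → k ≤ e → r < Ψ (x k)}) := frequently_mem_iff_neBot.1 hup
    obtain ⟨U, hUle⟩ := Ultrafilter.exists_le (atTop ⊓ 𝓟 {s | Ψ (x s) ≤ r ∧ ∃ e, s < e ∧
      r' ≤ Ψ (x e) ∧ ∀ k, s < k → k ≤ e → r < Ψ (x k)})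
    have hU : (U : Filter ℕ) ≤ atTop := hUle.trans inf_le_left
    have hUup : ∀ᶠ s in (U : Filter ℕ), Ψ (x s) ≤ r ∧ ∃ e, s < e ∧ r' ≤ Ψ (x e) ∧
        ∀ k, s < k → k ≤ e → r < Ψ (x k) := hUle.trans inf_le_right (mem_principal_self _)
    obtain ⟨Y, hYlip, hY⟩ := exists_limit_curve hηpos hdiv' hη0 hD hgxbd hy U hU
    have hY0 : Tendsto (fun s => y s) U (𝓝 (Y 0)) := by
      simpa only [indexAfter_zero hηpos hdiv'] using hY 0 le_rfl
    have hstart : Ψ (ψ (Y 0)) = r := by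
      refine le_antisymm (le_of_tendsto (hΨlim U Y 0 (fun s => s) hY0)
        (hUup.mono fun s hs => hs.1)) ?_
      have hsucc : Tendsto (fun s => y (s + 1)) U (𝓝 (Y 0)) := by
        have hdiff : Tendsto (fun s => y (s + 1) - y s) U (𝓝 0) := by
          refine Tendsto.mono_left (NormedAddGroup.tendsto_nhds_zero.2 fun ε hε => ?_) hU
          have hDη : Tendsto (fun s => D * η s) atTop (𝓝 0) := by simpa using hη0.const_mul D
          filter_upwards [eventually_norm_sub_le hηpos hD hy one_pos (half_pos hε),
            hη0.eventually_lt_const one_pos, hDη.eventually_lt_const (half_pos hε)] with s h1 h2 h3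
          have hstep : lamEta η (s + 1) = lamEta η s + η s := Finset.sum_range_succ _ _
          have := h1 s (s + 1) le_rfl (Nat.le_succ s) (by linarith)
          rw [hstep, add_sub_cancel_left] at this
          linarith
        simpa using hdiff.add hY0
      refine ge_of_tendsto (hΨlim U Y 0 (fun s => s + 1) hsucc) (hUup.mono fun s hs => ?_)
      obtain ⟨-, e, hse, -, hk⟩ := hs
      exact (hk (s + 1) (Nat.lt_succ_self s) hse).le
    obtain ⟨T, hT, hTlt, hTle⟩ := hdescent U hU Y hYlip hY fun h0 =>
      hrA ⟨_, h0, hstart⟩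
    rw [hstart] at hTlt hTle
    have hexit : ∀ᶠ s in (U : Filter ℕ), ∃ t ∈ Set.Icc (0 : ℝ) T,
        r' ≤ Ψ (x (indexAfter η s t)) := by
      filter_upwards [hUup, (hΨlim U Y T _ (hY T hT.le)).eventually_lt_const hTlt,
        hU (hη0.eventually_lt_const hT)] with s ⟨_, e, hse, he, hk⟩ hsT hηs
      have hstep : lamEta η (s + 1) = lamEta η s + η s := Finset.sum_range_succ _ _
      have hlt : s < indexAfter η s T := le_LamEta hdiv' (k := s + 1) (by linarith)
      have hmono := (lamEta_strictMono hηpos).monotone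
      have hle : e ≤ indexAfter η s T := by
        by_contra! hlt'
        exact lt_asymm hsT (hk _ hlt hlt'.le)
      refine ⟨lamEta η e - lamEta η s, ⟨sub_nonneg.2 (hmono hse.le), ?_⟩, ?_⟩
      · linarith [hmono hle, lamEta_indexAfter_le hηpos hdiv' s hT.le]
      · rwa [indexAfter_sub hηpos hdiv']
    obtain ⟨τ, hτ⟩ := hexit.choice
    obtain ⟨t, ht, hτt⟩ := (isCompact_Icc (a := (0 : ℝ)) (b := T)).ultrafilter_le_nhds (U.map τ)
      (le_principal_iff.2 (mem_map.2 (hτ.mono fun s hs => hs.1)))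
    have hYt := tendsto_indexAfter_of_tendsto hηpos hdiv' hη0 hD hy hU ht.1 (hY t ht.1)
      (hτ.mono fun s hs => hs.1.1) hτt
    have := ge_of_tendsto (hΨlim U Y t _ hYt) (hτ.mono fun s hs => hs.2)
    linarith [hTle t ht]
  refine ⟨?_, hconv⟩
  rintro xstar ⟨ks, hks, hxks⟩
  obtain ⟨c, hc⟩ := hconv
  obtain ⟨U, hUle⟩ := Ultrafilter.exists_le (map ks atTop)
  have hU : (U : Filter ℕ) ≤ atTop := hUle.trans hks.tendsto_atTop
  obtain ⟨Y, hYlip, hY⟩ := exists_limit_curve hηpos hdiv' hη0 hD hgxbd hy U hU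
  have hY0 : Tendsto (fun s => y s) U (𝓝 (Y 0)) := by
    simpa only [indexAfter_zero hηpos hdiv'] using hY 0 le_rfl
  have hxstar : xstar = ψ (Y 0) := by
    have h1 : Tendsto x U (𝓝 xstar) := Tendsto.mono_left (tendsto_map'_iff.2 hxks) hUle
    have h2 := (hψcont.tendsto (Y 0)).comp hY0
    simp only [Function.comp_def, hψy] at h2
    exact tendsto_nhds_unique h1 h2
  rw [hxstar]
  by_contra h0
  obtain ⟨T, hT, hTlt, -⟩ := hdescent U hU Y hYlip hY h0
  have hval : ∀ t, 0 ≤ t → Ψ (ψ (Y t)) = c := fun t ht =>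
    tendsto_nhds_unique (hΨlim U Y t _ (hY t ht))
      (hc.comp ((tendsto_atTop_mono (fun s => le_indexAfter hdiv' s ht) tendsto_id).mono_left hU))
  rw [hval T hT.le, hval 0 le_rfl] at hTlt
  exact lt_irrefl c hTlt
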